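/- arXiv:hep-th/0703111 — 2 statements merged into one kernel-verified Lean document; each statement's English description precedes it below -/
import Mathlib

section
/- Assume σ is invertible and let Ω := σ⁻¹ : V → V*. Then Ω is alternating, (Ω x)(y) = −(Ω y)(x) for all x, y ∈ V, and it is anti-invariant under both complex structures: J₊ᵗ ∘ Ω ∘ J₊ = −Ω and J₋ᵗ ∘ Ω ∘ J₋ = −Ω. -/
open Module LinearMap

variable (V : Type*) [AddCommGroup V] [Module ℝ V] [FiniteDimensional ℝ V]

/-- A linear map that squares to `-1` and preserves a bilinear form is skew for that form. -/
lemma bilin_apply_left_eq_neg_of_sq_eq_neg_one {W : Type*} [AddCommGroup W] [Module ℝ W]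
    {g : LinearMap.BilinForm ℝ W} {J : W →ₗ[ℝ] W} (hJ : ∀ x, J (J x) = -x)
    (hg : ∀ x y, g (J x) (J y) = g x y) (x y : W) : g (J x) y = -g x (J y) := by
  rw [← hg x (J y), hJ, map_neg, neg_neg]

/-- If `Ω ∘ C = g` with `C` surjective, an isometry of `g` anticommuting with `C` pulls `Ω` back
to `-Ω`. -/
lemma dualMap_comp_comp_eq_neg_of_anticommute {W : Type*} [AddCommGroup W] [Module ℝ W]
    {g : LinearMap.BilinForm ℝ W} {Ω : W →ₗ[ℝ] Module.Dual ℝ W} {C J : W →ₗ[ℝ] W}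
    (hC : Function.Surjective C) (hΩ : ∀ a, Ω (C a) = g a)
    (hg : ∀ x y, g (J x) (J y) = g x y) (hJC : ∀ a, J (C a) = -C (J a)) :
    J.dualMap ∘ₗ Ω ∘ₗ J = -Ω := by
  ext x y
  obtain ⟨a, rfl⟩ := hC x
  simp [hJC, hΩ, hg]

/-- assume `σ := [J₊,J₋] ∘ g⁻¹` is invertible with inverse
`Ω := σ⁻¹ : V → V*`. Then `Ω` is alternating, `(Ω x)(y) = -(Ω y)(x)`, and is
anti-invariant under both complex structures: `J±ᵗ ∘ Ω ∘ J± = -Ω`. -/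
theorem omega_alternating_anti_invariant
    (g : LinearMap.BilinForm ℝ V)
    (hgsymm : ∀ x y : V, g x y = g y x)
    (ginv : Module.Dual ℝ V →ₗ[ℝ] V)
    (hginv₁ : (g : V →ₗ[ℝ] Module.Dual ℝ V) ∘ₗ ginv = LinearMap.id)
    (hginv₂ : ginv ∘ₗ (g : V →ₗ[ℝ] Module.Dual ℝ V) = LinearMap.id)
    (Jp Jm : V →ₗ[ℝ] V)
    (hJp : Jp ∘ₗ Jp = -LinearMap.id) (hJm : Jm ∘ₗ Jm = -LinearMap.id)
    (hgp : ∀ x y : V, g (Jp x) (Jp y) = g x y)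
    (hgm : ∀ x y : V, g (Jm x) (Jm y) = g x y)
    (Ω : V →ₗ[ℝ] Module.Dual ℝ V)
    (hΩ₁ : Ω ∘ₗ ((Jp ∘ₗ Jm - Jm ∘ₗ Jp) ∘ₗ ginv) = LinearMap.id)
    (hΩ₂ : ((Jp ∘ₗ Jm - Jm ∘ₗ Jp) ∘ₗ ginv) ∘ₗ Ω = LinearMap.id) :
    (∀ x y : V, Ω x y = -(Ω y x)) ∧
    Jp.dualMap ∘ₗ Ω ∘ₗ Jp = -Ω ∧
    Jm.dualMap ∘ₗ Ω ∘ₗ Jm = -Ω := by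
  have hp (x : V) : Jp (Jp x) = -x := LinearMap.congr_fun hJp x
  have hm (x : V) : Jm (Jm x) = -x := LinearMap.congr_fun hJm x
  have hskp := bilin_apply_left_eq_neg_of_sq_eq_neg_one hp hgp
  have hskm := bilin_apply_left_eq_neg_of_sq_eq_neg_one hm hgm
  set C : V →ₗ[ℝ] V := Jp ∘ₗ Jm - Jm ∘ₗ Jp
  have hCapp (a : V) : C a = Jp (Jm a) - Jm (Jp a) := rfl
  have hC : Function.Surjective C := fun x => ⟨ginv (Ω x), LinearMap.congr_fun hΩ₂ x⟩
  have hΩ (a : V) : Ω (C a) = g a := by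
    have hga : ginv (g a) = a := LinearMap.congr_fun hginv₂ a
    simpa [hga] using LinearMap.congr_fun hΩ₁ (g a)
  have hCskew (a b : V) : g (C a) b = -g a (C b) := by
    simp only [hCapp, map_sub, LinearMap.sub_apply, hskp, hskm]
    ring
  refine ⟨fun x y => ?_,
    dualMap_comp_comp_eq_neg_of_anticommute hC hΩ hgp fun a => ?_,
    dualMap_comp_comp_eq_neg_of_anticommute hC hΩ hgm fun a => ?_⟩
  · obtain ⟨a, rfl⟩ := hC x
    obtain ⟨b, rfl⟩ := hC y
    rw [hΩ, hΩ, hgsymm b, hCskew, neg_neg]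
  · simp only [hCapp, map_sub, map_neg, hp]
    abel
  · simp only [hCapp, map_sub, map_neg, hm]
    abel
end

section
/- The Gualtieri maps commute, 𝒥₁ ∘ 𝒥₂ = 𝒥₂ ∘ 𝒥₁, and their product gives the generalized metric: −𝒥₁ ∘ 𝒥₂ = G, where G := e^B ∘ M_G ∘ e^{−B} with M_G(X,η) := (g⁻¹η, g X). -/
open Module LinearMap

variable (V : Type*) [AddCommGroup V] [Module ℝ V] [FiniteDimensional ℝ V]

/-- The natural pairing on `W = V × V*`:
`⟨(X,η),(Y,λ)⟩ := (1/2)(λ(X) + η(Y))`. -/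
noncomputable def naturalPairing :
    LinearMap.BilinForm ℝ (V × Module.Dual ℝ V) :=
  LinearMap.mk₂ ℝ (fun u v => (1 / 2 : ℝ) * (v.2 u.1 + u.2 v.1))
    (fun m₁ m₂ n => by simp; ring)
    (fun c m n => by simp; ring)
    (fun m n₁ n₂ => by simp; ring)
    (fun m c n => by simp; ring)

/-- The `b`-transform `e^b : W → W`, `e^b(X,η) := (X, η + b(X,·))`. -/
noncomputable def bTransform (b : LinearMap.BilinForm ℝ V) :
    (V × Module.Dual ℝ V) →ₗ[ℝ] V × Module.Dual ℝ V :=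
  (LinearMap.fst ℝ V (Module.Dual ℝ V)).prod
    (LinearMap.snd ℝ V (Module.Dual ℝ V) + b ∘ₗ LinearMap.fst ℝ V (Module.Dual ℝ V))

/-- The first Gualtieri map `𝒥₁ := e^B ∘ (1/2)·M₁ ∘ e^{-B}`, where
`M₁(X,η) := ((J₊ + J₋)X - (ω₊⁻¹ - ω₋⁻¹)η, (ω₊ - ω₋)X - (J₊ᵗ + J₋ᵗ)η)`,
with `ω± := g ∘ J±` and `ω±⁻¹` given by `ωpinv`, `ωminv`. -/
noncomputable def gualtieriJ1 (g : LinearMap.BilinForm ℝ V) (Jp Jm : V →ₗ[ℝ] V)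
    (ωpinv ωminv : Module.Dual ℝ V →ₗ[ℝ] V) (B : LinearMap.BilinForm ℝ V) :
    (V × Module.Dual ℝ V) →ₗ[ℝ] V × Module.Dual ℝ V :=
  bTransform V B ∘ₗ
    ((1 / 2 : ℝ) •
      (((Jp + Jm) ∘ₗ LinearMap.fst ℝ V (Module.Dual ℝ V)
          - (ωpinv - ωminv) ∘ₗ LinearMap.snd ℝ V (Module.Dual ℝ V)).prod
        (((g : V →ₗ[ℝ] Module.Dual ℝ V) ∘ₗ Jp - (g : V →ₗ[ℝ] Module.Dual ℝ V) ∘ₗ Jm)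
            ∘ₗ LinearMap.fst ℝ V (Module.Dual ℝ V)
          - (Jp.dualMap + Jm.dualMap) ∘ₗ LinearMap.snd ℝ V (Module.Dual ℝ V)))) ∘ₗ
    bTransform V (-B)

/-- The second Gualtieri map `𝒥₂ := e^B ∘ (1/2)·M₂ ∘ e^{-B}`, where
`M₂(X,η) := ((J₊ - J₋)X - (ω₊⁻¹ + ω₋⁻¹)η, (ω₊ + ω₋)X - (J₊ᵗ - J₋ᵗ)η)`,
with `ω± := g ∘ J±` and `ω±⁻¹` given by `ωpinv`, `ωminv`. -/
noncomputable def gualtieriJ2 (g : LinearMap.BilinForm ℝ V) (Jp Jm : V →ₗ[ℝ] V)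
    (ωpinv ωminv : Module.Dual ℝ V →ₗ[ℝ] V) (B : LinearMap.BilinForm ℝ V) :
    (V × Module.Dual ℝ V) →ₗ[ℝ] V × Module.Dual ℝ V :=
  bTransform V B ∘ₗ
    ((1 / 2 : ℝ) •
      (((Jp - Jm) ∘ₗ LinearMap.fst ℝ V (Module.Dual ℝ V)
          - (ωpinv + ωminv) ∘ₗ LinearMap.snd ℝ V (Module.Dual ℝ V)).prod
        (((g : V →ₗ[ℝ] Module.Dual ℝ V) ∘ₗ Jp + (g : V →ₗ[ℝ] Module.Dual ℝ V) ∘ₗ Jm)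
            ∘ₗ LinearMap.fst ℝ V (Module.Dual ℝ V)
          - (Jp.dualMap - Jm.dualMap) ∘ₗ LinearMap.snd ℝ V (Module.Dual ℝ V)))) ∘ₗ
    bTransform V (-B)

/-- The map `M_G(X,η) := (g⁻¹ η, g X)` on `W = V × V*`. -/
noncomputable def MG (g : LinearMap.BilinForm ℝ V) (ginv : Module.Dual ℝ V →ₗ[ℝ] V) :
    (V × Module.Dual ℝ V) →ₗ[ℝ] V × Module.Dual ℝ V :=
  (ginv ∘ₗ LinearMap.snd ℝ V (Module.Dual ℝ V)).prod
    ((g : V →ₗ[ℝ] Module.Dual ℝ V) ∘ₗ LinearMap.fst ℝ V (Module.Dual ℝ V))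

section BlockForm

variable {V : Type*} [AddCommGroup V] [Module ℝ V]
variable {g : LinearMap.BilinForm ℝ V}

theorem map_map_of_comp_eq_neg_id {J : V →ₗ[ℝ] V} (hJ : J ∘ₗ J = -LinearMap.id) (x : V) :
    J (J x) = -x := by
  simpa using LinearMap.congr_fun hJ x

theorem dualMap_apply_of_isometry {J : V →ₗ[ℝ] V} (hJ : J ∘ₗ J = -LinearMap.id)
    (hg : ∀ x y : V, g (J x) (J y) = g x y) (y : V) : J.dualMap (g y) = -g (J y) := by
  ext x
  rw [LinearMap.dualMap_apply, ← hg y (J x), map_map_of_comp_eq_neg_id hJ]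
  simp

theorem inv_apply_of_comp_eq_id {J : V →ₗ[ℝ] V} (hJ : J ∘ₗ J = -LinearMap.id)
    {ωinv : Module.Dual ℝ V →ₗ[ℝ] V}
    (hω : ωinv ∘ₗ ((g : V →ₗ[ℝ] Module.Dual ℝ V) ∘ₗ J) = LinearMap.id) (y : V) :
    ωinv (g y) = -J y := by
  have h := LinearMap.congr_fun hω (J y)
  simp only [LinearMap.comp_apply, LinearMap.id_apply, map_map_of_comp_eq_neg_id hJ,
    map_neg] at h
  rw [← h, neg_neg]

variable {Jp Jm : V →ₗ[ℝ] V} {ωpinv ωminv : Module.Dual ℝ V →ₗ[ℝ] V}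

theorem bTransform_neg_bTransform (B : LinearMap.BilinForm ℝ V)
    (w : V × Module.Dual ℝ V) :
    bTransform V (-B) (bTransform V B w) = w := by
  ext <;> simp [bTransform]

theorem bTransform_bTransform_neg (B : LinearMap.BilinForm ℝ V)
    (w : V × Module.Dual ℝ V) :
    bTransform V B (bTransform V (-B) w) = w := by
  ext <;> simp [bTransform]

theorem gualtieriJ1_bTransform
    (hdp : ∀ y, Jp.dualMap (g y) = -g (Jp y)) (hdm : ∀ y, Jm.dualMap (g y) = -g (Jm y))
    (hωp : ∀ y, ωpinv (g y) = -Jp y) (hωm : ∀ y, ωminv (g y) = -Jm y)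
    (B : LinearMap.BilinForm ℝ V) (x y : V) :
    gualtieriJ1 V g Jp Jm ωpinv ωminv B (bTransform V B (x, g y)) =
      bTransform V B ((1 / 2 : ℝ) • (Jp (x + y) + Jm (x - y)),
        g ((1 / 2 : ℝ) • (Jp (x + y) - Jm (x - y)))) := by
  rw [gualtieriJ1, LinearMap.comp_apply, LinearMap.comp_apply, bTransform_neg_bTransform]
  congr 1
  ext1
  · change (1 / 2 : ℝ) • ((Jp x + Jm x) - (ωpinv (g y) - ωminv (g y))) = _
    simp only [hωp, hωm, map_add, map_sub]
    module
  · change (1 / 2 : ℝ) • ((g (Jp x) - g (Jm x)) - (Jp.dualMap (g y) + Jm.dualMap (g y))) = g _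
    simp only [hdp, hdm, map_smul, map_add, map_sub]
    module

theorem gualtieriJ2_bTransform
    (hdp : ∀ y, Jp.dualMap (g y) = -g (Jp y)) (hdm : ∀ y, Jm.dualMap (g y) = -g (Jm y))
    (hωp : ∀ y, ωpinv (g y) = -Jp y) (hωm : ∀ y, ωminv (g y) = -Jm y)
    (B : LinearMap.BilinForm ℝ V) (x y : V) :
    gualtieriJ2 V g Jp Jm ωpinv ωminv B (bTransform V B (x, g y)) =
      bTransform V B ((1 / 2 : ℝ) • (Jp (x + y) - Jm (x - y)),
        g ((1 / 2 : ℝ) • (Jp (x + y) + Jm (x - y)))) := by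
  rw [gualtieriJ2, LinearMap.comp_apply, LinearMap.comp_apply, bTransform_neg_bTransform]
  congr 1
  ext1
  · change (1 / 2 : ℝ) • ((Jp x - Jm x) - (ωpinv (g y) + ωminv (g y))) = _
    simp only [hωp, hωm, map_add, map_sub]
    module
  · change (1 / 2 : ℝ) • ((g (Jp x) + g (Jm x)) - (Jp.dualMap (g y) - Jm.dualMap (g y))) = g _
    simp only [hdp, hdm, map_smul, map_add, map_sub]
    module

end BlockForm

/-- the Gualtieri maps commute, `𝒥₁ ∘ 𝒥₂ = 𝒥₂ ∘ 𝒥₁`, and their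
product gives the generalized metric: `-𝒥₁ ∘ 𝒥₂ = G := e^B ∘ M_G ∘ e^{-B}`. -/
theorem gualtieri_maps_commute_product_metric
    (g : LinearMap.BilinForm ℝ V)
    (hgsymm : ∀ x y : V, g x y = g y x)
    (ginv : Module.Dual ℝ V →ₗ[ℝ] V)
    (hginv₁ : (g : V →ₗ[ℝ] Module.Dual ℝ V) ∘ₗ ginv = LinearMap.id)
    (hginv₂ : ginv ∘ₗ (g : V →ₗ[ℝ] Module.Dual ℝ V) = LinearMap.id)
    (Jp Jm : V →ₗ[ℝ] V)
    (hJp : Jp ∘ₗ Jp = -LinearMap.id) (hJm : Jm ∘ₗ Jm = -LinearMap.id)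
    (hgp : ∀ x y : V, g (Jp x) (Jp y) = g x y)
    (hgm : ∀ x y : V, g (Jm x) (Jm y) = g x y)
    (ωpinv ωminv : Module.Dual ℝ V →ₗ[ℝ] V)
    (hωp₁ : ((g : V →ₗ[ℝ] Module.Dual ℝ V) ∘ₗ Jp) ∘ₗ ωpinv = LinearMap.id)
    (hωp₂ : ωpinv ∘ₗ ((g : V →ₗ[ℝ] Module.Dual ℝ V) ∘ₗ Jp) = LinearMap.id)
    (hωm₁ : ((g : V →ₗ[ℝ] Module.Dual ℝ V) ∘ₗ Jm) ∘ₗ ωminv = LinearMap.id)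
    (hωm₂ : ωminv ∘ₗ ((g : V →ₗ[ℝ] Module.Dual ℝ V) ∘ₗ Jm) = LinearMap.id)
    (B : LinearMap.BilinForm ℝ V) (hB : B.IsAlt) :
    gualtieriJ1 V g Jp Jm ωpinv ωminv B ∘ₗ gualtieriJ2 V g Jp Jm ωpinv ωminv B
      = gualtieriJ2 V g Jp Jm ωpinv ωminv B ∘ₗ gualtieriJ1 V g Jp Jm ωpinv ωminv B ∧
    -(gualtieriJ1 V g Jp Jm ωpinv ωminv B ∘ₗ gualtieriJ2 V g Jp Jm ωpinv ωminv B)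
      = bTransform V B ∘ₗ MG V g ginv ∘ₗ bTransform V (-B) := by
  have hJ₁ := gualtieriJ1_bTransform (dualMap_apply_of_isometry hJp hgp)
    (dualMap_apply_of_isometry hJm hgm) (inv_apply_of_comp_eq_id hJp hωp₂)
    (inv_apply_of_comp_eq_id hJm hωm₂) B
  have hJ₂ := gualtieriJ2_bTransform (dualMap_apply_of_isometry hJp hgp)
    (dualMap_apply_of_isometry hJm hgm) (inv_apply_of_comp_eq_id hJp hωp₂)
    (inv_apply_of_comp_eq_id hJm hωm₂) B
  have hJp' := map_map_of_comp_eq_neg_id hJp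
  have hJm' := map_map_of_comp_eq_neg_id hJm
  have hsurj (w : V × Module.Dual ℝ V) : ∃ x y, w = bTransform V B (x, g y) := by
    refine ⟨(bTransform V (-B) w).1, ginv (bTransform V (-B) w).2, ?_⟩
    rw [← LinearMap.comp_apply g, hginv₁, LinearMap.id_apply, Prod.mk.eta,
      bTransform_bTransform_neg]
  have h₁₂ (x y : V) : gualtieriJ1 V g Jp Jm ωpinv ωminv B
      (gualtieriJ2 V g Jp Jm ωpinv ωminv B (bTransform V B (x, g y))) =
        bTransform V B (-y, g (-x)) := by
    rw [hJ₂, hJ₁]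
    congr 3 <;> simp only [map_smul, map_add, map_sub, hJp', hJm'] <;> module
  have h₂₁ (x y : V) : gualtieriJ2 V g Jp Jm ωpinv ωminv B
      (gualtieriJ1 V g Jp Jm ωpinv ωminv B (bTransform V B (x, g y))) =
        bTransform V B (-y, g (-x)) := by
    rw [hJ₁, hJ₂]
    congr 3 <;> simp only [map_smul, map_add, map_sub, hJp', hJm'] <;> module
  refine ⟨LinearMap.ext fun w => ?_, LinearMap.ext fun w => ?_⟩ <;>
    obtain ⟨x, y, rfl⟩ := hsurj w
  · rw [LinearMap.comp_apply, LinearMap.comp_apply, h₁₂, h₂₁]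
  · have hy : ginv (g y) = y := LinearMap.congr_fun hginv₂ y
    rw [LinearMap.neg_apply, LinearMap.comp_apply, h₁₂, LinearMap.comp_apply,
      LinearMap.comp_apply, bTransform_neg_bTransform, ← map_neg]
    simp [MG, hy]
end
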